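/- Let a = (a_1,…,a_m) be an m-tuple of positive integers with n = a_1+⋯+a_m, and let J_a be the m×m Jacobian matrix over ℂ[z_1,…,z_m] with (i,j)-entry ∂/∂z_i (p_a(z_j)). Then the coefficient of the monomial ∏_{j=1}^m z_j^{n} in det J_a equals (−1)^n. -/

import Mathlib

open Finset in
/-- A derivation acts on a product of powers of eigenvectors by the weighted sum of the
eigenvalues. -/
theorem Derivation.map_prod_pow_of_eigen {K A ι : Type*} [CommRing K] [CommRing A] [Algebra K A]
    (D : Derivation K A A) (s : Finset ι) (f c : ι → A) (a : ι → ℕ)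
    (h : ∀ i ∈ s, D (f i) = c i * f i) :
    D (∏ i ∈ s, f i ^ a i) = (∑ i ∈ s, a i * c i) * ∏ i ∈ s, f i ^ a i := by
  classical
  induction s using Finset.induction_on with
  | empty => simp
  | insert i s his ih =>
    have hpow : D (f i ^ a i) = a i * c i * f i ^ a i := by
      rw [D.leibniz_pow, h i (mem_insert_self i s)]
      rcases Nat.eq_zero_or_pos (a i) with h0 | h0
      · simp [h0]
      · obtain ⟨k, hk⟩ := Nat.exists_eq_succ_of_ne_zero h0.ne'
        simp only [hk, nsmul_eq_mul, smul_eq_mul, Nat.succ_sub_one, pow_succ]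
        ring
    rw [prod_insert his, sum_insert his, D.leibniz, hpow,
      ih fun j hj => h j (mem_insert_of_mem hj)]
    simp only [smul_eq_mul]
    ring

/-- The derivation of `A[X]` that applies a derivation of `A` to every coefficient. -/
noncomputable def Derivation.coeffwise {K A : Type*} [CommRing K] [CommRing A] [Algebra K A]
    (d : Derivation K A A) : Derivation K (Polynomial A) (Polynomial A) :=
  PolynomialModule.equivPolynomialSelf.compDer d.mapCoeffs

section Coeffwise

variable {K A : Type*} [CommRing K] [CommRing A] [Algebra K A] (d : Derivation K A A)

theorem Derivation.coeff_coeffwise (p : Polynomial A) (k : ℕ) :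
    (d.coeffwise p).coeff k = d (p.coeff k) := rfl

theorem Derivation.coeffwise_monomial (k : ℕ) (x : A) :
    d.coeffwise (Polynomial.monomial k x) = Polynomial.monomial k (d x) := by
  ext j
  simp only [d.coeff_coeffwise, Polynomial.coeff_monomial]
  split_ifs <;> simp

theorem Derivation.coeffwise_C (x : A) :
    d.coeffwise (Polynomial.C x) = Polynomial.C (d x) :=
  d.coeffwise_monomial 0 x

theorem Derivation.coeffwise_X : d.coeffwise (Polynomial.X : Polynomial A) = 0 := by
  rw [← Polynomial.monomial_one_one_eq_X, d.coeffwise_monomial]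
  simp

theorem Derivation.derivative_coeffwise (p : Polynomial A) :
    Polynomial.derivative (d.coeffwise p) = d.coeffwise (Polynomial.derivative p) := by
  ext k
  simp only [Polynomial.coeff_derivative, d.coeff_coeffwise]
  rw [← Nat.cast_succ, d.leibniz, d.map_natCast]
  simp [mul_comm]

theorem Derivation.map_eval (x : A) (p : Polynomial A) :
    d (p.eval x) = (d.coeffwise p).eval x + (Polynomial.derivative p).eval x * d x := by
  induction p using Polynomial.induction_on' with
  | add p q hp hq => simp only [Polynomial.eval_add, map_add, hp, hq]; ring
  | monomial k c =>
    simp only [d.coeffwise_monomial, Polynomial.derivative_monomial, Polynomial.eval_monomial,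
      d.leibniz, d.leibniz_pow, smul_eq_mul, nsmul_eq_mul]
    ring

end Coeffwise

namespace Polynomial

theorem exists_antiderivative {A : Type*} [CommRing A] [Algebra ℚ A] (q : A[X]) :
    ∃ p : A[X], derivative p = q ∧ p.coeff 0 = 0 := by
  induction q using Polynomial.induction_on' with
  | add q₁ q₂ h₁ h₂ =>
    obtain ⟨p₁, h₁, h₁'⟩ := h₁
    obtain ⟨p₂, h₂, h₂'⟩ := h₂
    exact ⟨p₁ + p₂, by simp [h₁, h₂], by simp [h₁', h₂']⟩
  | monomial k c =>
    refine ⟨monomial (k + 1) (algebraMap ℚ A ((k + 1 : ℚ)⁻¹) * c), ?_, ?_⟩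
    · rw [derivative_monomial]
      have : algebraMap ℚ A ((k + 1 : ℚ)⁻¹) * ((k + 1 : ℕ) : A) = 1 := by
        rw [← map_natCast (algebraMap ℚ A), ← map_mul]
        rw [Nat.cast_succ, inv_mul_cancel₀ (by positivity), map_one]
      rw [mul_right_comm, this, one_mul, Nat.add_sub_cancel]
    · simp [coeff_monomial]

theorem eq_of_derivative_eq {A : Type*} [CommRing A] [IsDomain A] [CharZero A] {p q : A[X]}
    (h : derivative p = derivative q) (h0 : p.coeff 0 = q.coeff 0) : p = q := by
  have h' : derivative (p - q) = 0 := by rw [derivative_sub, h, sub_self]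
  have := eq_C_of_derivative_eq_zero h'
  rw [coeff_sub, h0, sub_self, C_0] at this
  exact sub_eq_zero.mp this

end Polynomial

theorem Matrix.det_updateRow_diagonal {ι A : Type*} [Fintype ι] [DecidableEq ι] [CommRing A]
    (d w : ι → A) (r : ι) :
    ((Matrix.diagonal d).updateRow r w).det = w r * ∏ i ∈ Finset.univ.erase r, d i := by
  rw [← Matrix.cramer_transpose_apply, Matrix.cramer_eq_adjugate_mulVec,
    Matrix.diagonal_transpose, Matrix.adjugate_diagonal, Matrix.mulVec_diagonal, mul_comm]

theorem Matrix.det_diagonal_sub_vecMulVec {ι K A : Type*} [Fintype ι] [DecidableEq ι] [Field K]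
    [CommRing A] [Algebra K A] (d v : ι → A) (u : ι → K) (r : ι) (hd : d r = 0) (hu : u r ≠ 0) :
    (Matrix.diagonal d - Matrix.vecMulVec (fun i => algebraMap K A (u i)) v).det =
      -(algebraMap K A (u r) * v r) * ∏ i ∈ Finset.univ.erase r, d i := by
  rw [← Matrix.det_updateRow_diagonal d (fun j => -(algebraMap K A (u r) * v j)) r]
  refine Matrix.det_eq_of_forall_row_eq_smul_add_const
    (fun i => if i = r then 0 else algebraMap K A (u i / u r)) r (by simp) fun i j => ?_
  by_cases hi : i = r
  · subst hi
    by_cases hij : i = j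
    · subst hij
      simp [Matrix.vecMulVec_apply, hd]
    · simp [Matrix.vecMulVec_apply, Matrix.diagonal_apply_ne _ hij]
  · have : algebraMap K A (u i / u r) * algebraMap K A (u r) = algebraMap K A (u i) := by
      rw [← map_mul, div_mul_cancel₀ _ hu]
    simp only [Matrix.sub_apply, Matrix.vecMulVec_apply, Matrix.updateRow_ne hi,
      Matrix.updateRow_self, if_neg hi, ← this]
    ring

/-- Good's form of Lagrange interpolation: a common multiple of the products
`∏ (z i - z r)` is the sum of its cofactors weighted by the products `∏ z i`. -/
theorem Finset.eq_sum_prod_erase_mul {ι A : Type*} [DecidableEq ι] [CommRing A] [IsDomain A]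
    (s : Finset ι) (hs : s.Nonempty) (z : ι → A) (hz : Set.InjOn z s) (f : A) (g : ι → A)
    (h : ∀ r ∈ s, f = (∏ i ∈ s.erase r, (z i - z r)) * g r) :
    f = ∑ r ∈ s, (∏ i ∈ s.erase r, z i) * g r := by
  let φ := algebraMap A (FractionRing A)
  have hφ : Function.Injective φ := IsFractionRing.injective A (FractionRing A)
  have hone := congrArg (Polynomial.eval 0)
    (Lagrange.sum_basis (s := s) (v := φ ∘ z) (hφ.comp_injOn hz) hs)
  rw [Polynomial.eval_finsetSum, Polynomial.eval_one] at hone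
  apply hφ
  rw [← one_mul (φ f), ← hone, Finset.sum_mul, map_sum]
  refine Finset.sum_congr rfl fun r hr => ?_
  rw [h r hr, map_mul, map_mul, map_prod, map_prod, ← mul_assoc, Lagrange.basis,
    Polynomial.eval_prod, ← Finset.prod_mul_distrib]
  congr 1
  refine Finset.prod_congr rfl fun i hi => ?_
  obtain ⟨hir, his⟩ := Finset.mem_erase.mp hi
  have hne : φ (z r) - φ (z i) ≠ 0 :=
    sub_ne_zero.mpr fun e => hir (hz his hr (hφ e.symm))
  simp only [Lagrange.basisDivisor, Function.comp_apply, Polynomial.eval_mul, Polynomial.eval_C,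
    Polynomial.eval_sub, Polynomial.eval_X, map_sub]
  field_simp
  ring

namespace MvPolynomial

variable {σ K : Type*} [Field K]

theorem degreeOf_X_sub_X_mul_le {i k r : σ} (hir : i ≠ r) (hik : i ≠ k) (q : MvPolynomial σ K) :
    degreeOf i ((X k - X r) * q) ≤ degreeOf i q := by
  refine (degreeOf_mul_le _ _ _).trans ?_
  have := degreeOf_sub_le i (X k : MvPolynomial σ K) (X r)
  rw [degreeOf_X_of_ne hik, degreeOf_X_of_ne hir] at this
  simpa using this

theorem coeff_prod_X_sub_X_mul [DecidableEq σ] (t : Finset σ) {r : σ} (hr : r ∉ t)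
    (d : σ →₀ ℕ) (q : MvPolynomial σ K) (hq : ∀ i ∈ t, degreeOf i q < d i) :
    coeff d ((∏ i ∈ t, (X i - X r)) * q) = coeff d ((∏ i ∈ t, X i) * q) := by
  induction t using Finset.induction_on generalizing q with
  | empty => simp
  | insert k t hk ih =>
    have hkr : k ≠ r := fun e => hr (e ▸ Finset.mem_insert_self k t)
    have hrt : r ∉ t := fun e => hr (Finset.mem_insert_of_mem e)
    rw [Finset.prod_insert hk, Finset.prod_insert hk, mul_comm (X k - X r), mul_assoc,
      ih hrt _ fun i hi => (degreeOf_X_sub_X_mul_le (ne_of_mem_of_not_mem hi hrt)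
        (ne_of_mem_of_not_mem hi hk) q).trans_lt (hq i (Finset.mem_insert_of_mem hi))]
    have hsplit : (∏ i ∈ t, X i) * ((X k - X r) * q) =
        X k * (∏ i ∈ t, X i) * q - X r * (∏ i ∈ t, X i) * q := by ring
    have hdeg : degreeOf k (X r * (∏ i ∈ t, X i) * q) < d k := by
      refine lt_of_le_of_lt ?_ (hq k (Finset.mem_insert_self k t))
      refine (degreeOf_mul_le _ _ _).trans ?_
      have h₁ := degreeOf_mul_le k (X r : MvPolynomial σ K) (∏ i ∈ t, X i)
      have h₂ := degreeOf_prod_le k t fun i => (X i : MvPolynomial σ K)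
      rw [Finset.sum_eq_zero fun i hi => degreeOf_X_of_ne (ne_of_mem_of_not_mem hi hk).symm] at h₂
      rw [degreeOf_X_of_ne hkr] at h₁
      omega
    rw [hsplit, coeff_sub, notMem_support_iff.mp (notMem_support_of_degreeOf_lt k hdeg), sub_zero]

theorem exists_eq_add_single [DecidableEq σ] {a : σ → ℕ} {r : σ} (hr : a r ≠ 0) :
    ∃ b : σ → ℕ, a = b + (Pi.single r 1 : σ → ℕ) := by
  refine ⟨a - Pi.single r 1, ?_⟩
  funext i
  by_cases h : i = r
  · subst h
    simp
    omega
  · simp [h]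

theorem sum_add_single [Fintype σ] [DecidableEq σ] (b : σ → ℕ) (r : σ) :
    ∑ i, (b + (Pi.single r 1 : σ → ℕ)) i = ∑ i, b i + 1 := by
  simp [Finset.sum_add_distrib]

theorem degreeOf_le_of_dyson_recurrence [Fintype σ] [DecidableEq σ] [CharZero K]
    (F : (σ → ℕ) → MvPolynomial σ K) (hzero : F 0 = 1)
    (hstep : ∀ a r, C ((∑ i, a i : ℕ) + 1 : K) * F (a + Pi.single r 1) =
      -(C (a r + 1 : K) * X r) * (∏ i ∈ Finset.univ.erase r, (X i - X r)) * F a)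
    (n : ℕ) (a : σ → ℕ) (hn : ∑ i, a i = n) (i : σ) (hi : a i = 0) :
    degreeOf i (F a) ≤ n := by
  induction n generalizing a with
  | zero =>
    have : a = 0 := _root_.funext fun k => (Finset.sum_eq_zero_iff.mp hn) k (Finset.mem_univ k)
    rw [this, hzero, degreeOf_one]
  | succ n ih =>
    obtain ⟨r, -, hr⟩ := Finset.exists_ne_zero_of_sum_ne_zero (hn.trans_ne n.succ_ne_zero)
    have hir : i ≠ r := fun e => hr (e ▸ hi)
    obtain ⟨b, rfl⟩ := exists_eq_add_single hr
    have hbn : ∑ i, b i = n := by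
      rw [sum_add_single] at hn
      omega
    have hbi : b i = 0 := by simpa [hir] using hi
    have hc : ((n : K) + 1) ≠ 0 := Nat.cast_add_one_ne_zero n
    have hF : F (b + Pi.single r 1) = C (-((n : K) + 1)⁻¹ * (b r + 1)) *
        (X r * ((∏ k ∈ Finset.univ.erase r, (X k - X r)) * F b)) := by
      have h := congrArg (C ((n : K) + 1)⁻¹ * ·) (hstep b r)
      simp only [hbn, ← mul_assoc, ← C_mul, inv_mul_cancel₀ hc, C_1, one_mul] at h
      rw [h]
      simp only [C_mul, C_neg]
      ring
    have hprod : degreeOf i (∏ k ∈ Finset.univ.erase r, (X k - X r : MvPolynomial σ K)) ≤ 1 := by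
      refine (degreeOf_prod_le _ _ _).trans ?_
      have hterm : ∀ k ∈ Finset.univ.erase r,
          degreeOf i (X k - X r : MvPolynomial σ K) ≤ if i = k then 1 else 0 := fun k _ => by
        refine (degreeOf_sub_le _ _ _).trans ?_
        rw [degreeOf_X_of_ne hir, degreeOf_X]
        simp
      refine (Finset.sum_le_sum hterm).trans ?_
      rw [Finset.sum_ite_eq]
      split_ifs <;> simp
    rw [hF]
    refine (degreeOf_C_mul_le _ _ _).trans ((degreeOf_mul_le _ _ _).trans ?_)
    rw [degreeOf_X_of_ne hir, zero_add]
    refine (degreeOf_mul_le _ _ _).trans ?_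
    have := ih b hbn hbi
    omega

theorem coeff_of_dyson_recurrence [Fintype σ] [DecidableEq σ] [CharZero K]
    (F : (σ → ℕ) → MvPolynomial σ K) (hzero : F 0 = 1)
    (hstep : ∀ a r, C ((∑ i, a i : ℕ) + 1 : K) * F (a + Pi.single r 1) =
      -(C (a r + 1 : K) * X r) * (∏ i ∈ Finset.univ.erase r, (X i - X r)) * F a)
    (n : ℕ) (a : σ → ℕ) (hn : ∑ i, a i = n) :
    coeff (Finsupp.equivFunOnFinite.symm fun _ => n) (F a) = (-1 : K) ^ n := by
  induction n generalizing a with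
  | zero =>
    have : a = 0 := _root_.funext fun k => (Finset.sum_eq_zero_iff.mp hn) k (Finset.mem_univ k)
    rw [this, hzero, coeff_one, if_pos (by ext; simp), pow_zero]
  | succ n ih =>
    set s : Finset σ := Finset.univ.filter fun r => a r ≠ 0 with hs
    have hmem : ∀ r, r ∈ s ↔ a r ≠ 0 := fun r => by simp [hs]
    have hne : s.Nonempty := by
      obtain ⟨r, -, hr⟩ := Finset.exists_ne_zero_of_sum_ne_zero (hn.trans_ne n.succ_ne_zero)
      exact ⟨r, (hmem r).mpr hr⟩
    let g : σ → MvPolynomial σ K := fun r =>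
      -(C (a r : K) * X r) * ((∏ i ∈ sᶜ, (X i - X r)) * F (a - Pi.single r 1))
    have hg : C ((n : K) + 1) * F a = ∑ r ∈ s, (∏ i ∈ s.erase r, X i) * g r := by
      refine Finset.eq_sum_prod_erase_mul s hne X (X_injective.injOn) _ g fun r hr => ?_
      obtain ⟨b, hb⟩ := exists_eq_add_single ((hmem r).mp hr)
      have hsub : a - Pi.single r 1 = b := by rw [hb, add_tsub_cancel_right]
      have hbn : ∑ i, b i = n := by
        rw [hb, sum_add_single] at hn
        omega
      have har : (a r : K) = b r + 1 := by simp [hb]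
      have hsplit : Finset.univ.erase r = s.erase r ∪ sᶜ := by
        ext i
        by_cases h : i = r <;> by_cases h' : i ∈ s <;> simp_all
      have hdisj : Disjoint (s.erase r) sᶜ :=
        Finset.disjoint_of_subset_left (Finset.erase_subset r s) disjoint_compl_right
      have h := hstep b r
      rw [← hb, hbn, hsplit, Finset.prod_union hdisj] at h
      simp only [g]
      rw [h, hsub, har]
      ring
    have hcoeff : ∀ r ∈ s, coeff (Finsupp.equivFunOnFinite.symm fun _ => n + 1)
        ((∏ i ∈ s.erase r, X i) * g r) = a r * (-1 : K) ^ (n + 1) := fun r hr => by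
      obtain ⟨b, hb⟩ := exists_eq_add_single ((hmem r).mp hr)
      have hsub : a - Pi.single r 1 = b := by rw [hb, add_tsub_cancel_right]
      have hbn : ∑ i, b i = n := by
        rw [hb, sum_add_single] at hn
        omega
      have hrs : r ∉ sᶜ := by simpa using hr
      have hrw : (∏ i ∈ s.erase r, X i) * g r = C (-(a r : K)) *
          ((∏ i ∈ sᶜ, (X i - X r)) * ((∏ i ∈ s, X i) * F b)) := by
        simp only [g]
        rw [hsub, ← Finset.mul_prod_erase s _ hr, C_neg]
        ring
      have hdeg : ∀ i ∈ sᶜ, degreeOf i ((∏ i ∈ s, X i) * F b) <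
          (Finsupp.equivFunOnFinite.symm fun _ : σ => n + 1) i := fun i hi => by
        have his : i ∉ s := Finset.mem_compl.mp hi
        have hbi : b i = 0 := by
          have := (hmem i).not_left.mp his
          rw [hb] at this
          simp at this
          exact this.1
        have h₁ := degreeOf_le_of_dyson_recurrence F hzero hstep n b hbn i hbi
        have h₂ := degreeOf_prod_le i s fun k => (X k : MvPolynomial σ K)
        rw [Finset.sum_eq_zero fun k hk =>
          degreeOf_X_of_ne (ne_of_mem_of_not_mem hk his).symm] at h₂
        have h₃ := degreeOf_mul_le i (∏ i ∈ s, X i) (F b)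
        simp only [Finsupp.equivFunOnFinite_symm_apply_apply]
        omega
      have hprod : (∏ i ∈ sᶜ, X i) * ((∏ i ∈ s, X i) * F b) =
          monomial (Finsupp.equivFunOnFinite.symm fun _ => 1) 1 * F b := by
        rw [← mul_assoc, Finset.prod_compl_mul_prod, monomial_eq]
        simp [Finsupp.prod_fintype]
      have hexp : (Finsupp.equivFunOnFinite.symm fun _ : σ => n + 1) =
          (Finsupp.equivFunOnFinite.symm fun _ => 1) +
            Finsupp.equivFunOnFinite.symm fun _ => n := by
        ext i
        simp [add_comm]
      rw [hrw, coeff_C_mul, coeff_prod_X_sub_X_mul sᶜ hrs _ _ hdeg, hprod, hexp,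
        coeff_monomial_mul, ih b hbn, pow_succ]
      ring
    have hsum : (∑ r ∈ s, (a r : K)) = n + 1 := by
      rw [hs, Finset.sum_filter_of_ne fun r _ h => Nat.cast_ne_zero.mp h, ← Nat.cast_sum, hn,
        Nat.cast_succ]
    have h := congrArg (coeff (Finsupp.equivFunOnFinite.symm fun _ => n + 1)) hg
    rw [coeff_C_mul, coeff_sum, Finset.sum_congr rfl hcoeff, ← Finset.sum_mul, hsum] at h
    exact mul_left_cancel₀ (Nat.cast_add_one_ne_zero n) h

/-- The polynomial `∏ (w - z_i) ^ a_i` in the variable `w`. -/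
noncomputable def rootProduct [Fintype σ] (a : σ → ℕ) : Polynomial (MvPolynomial σ K) :=
  ∏ i, (Polynomial.X - Polynomial.C (X i)) ^ a i

theorem rootProduct_add_single [Fintype σ] [DecidableEq σ] (a : σ → ℕ) (r : σ) :
    (rootProduct (a + Pi.single r 1) : Polynomial (MvPolynomial σ K)) =
      (Polynomial.X - Polynomial.C (X r)) * rootProduct a := by
  simp only [rootProduct, Pi.add_apply, pow_add, Finset.prod_mul_distrib]
  rw [mul_comm]
  congr 1
  rw [Finset.prod_eq_single r (fun i _ hi => by simp [hi]) (by simp)]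
  simp

theorem mul_coeffwise_pderiv_rootProduct [Fintype σ] [DecidableEq σ] (a : σ → ℕ) (i : σ) :
    (Polynomial.X - Polynomial.C (X i)) * (pderiv i).coeffwise (rootProduct a) =
      -(a i : Polynomial (MvPolynomial σ K)) * rootProduct a := by
  have h := Derivation.map_prod_pow_of_eigen
    ((Polynomial.X - Polynomial.C (X i) : Polynomial (MvPolynomial σ K)) •
      (pderiv (R := K) i).coeffwise) Finset.univ
    (fun k => Polynomial.X - Polynomial.C (X k)) (fun k => if k = i then -1 else 0) a
    fun k _ => by
      rw [Derivation.smul_apply, map_sub, Derivation.coeffwise_X, Derivation.coeffwise_C,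
        pderiv_X]
      by_cases hk : k = i
      · subst hk
        simp
        ring
      · simp [hk]
  simp only [Derivation.smul_apply, smul_eq_mul, mul_ite, mul_neg, mul_one, mul_zero,
    Finset.sum_ite_eq', Finset.mem_univ, if_true] at h
  exact h

/-- Euler's identity for `∏ (w - z_i) ^ a_i`. -/
theorem euler_rootProduct [Fintype σ] [DecidableEq σ] (a : σ → ℕ) :
    Polynomial.X * Polynomial.derivative (rootProduct a) +
        ∑ k, Polynomial.C (X k) * (pderiv k).coeffwise (rootProduct a) =
      ((∑ k, a k : ℕ) : Polynomial (MvPolynomial σ K)) * rootProduct a := by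
  let E : Derivation K (Polynomial (MvPolynomial σ K)) (Polynomial (MvPolynomial σ K)) :=
    (Polynomial.X : Polynomial (MvPolynomial σ K)) • Polynomial.derivative'.restrictScalars K +
      ∑ k, (Polynomial.C (X k) : Polynomial (MvPolynomial σ K)) • (pderiv (R := K) k).coeffwise
  have hE : ∀ q, E q = Polynomial.X * Polynomial.derivative q +
      ∑ k, Polynomial.C (X k) * (pderiv k).coeffwise q := fun q => by
    have := congrFun (map_sum Derivation.coeFnAddMonoidHom (fun k =>
      (Polynomial.C (X k) : Polynomial (MvPolynomial σ K)) • (pderiv (R := K) k).coeffwise)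
      Finset.univ) q
    rw [Finset.sum_apply] at this
    exact congrArg (Polynomial.X * Polynomial.derivative q + ·) this
  have h := E.map_prod_pow_of_eigen Finset.univ
    (fun k => Polynomial.X - Polynomial.C (X k)) (fun _ => 1) a fun k _ => by
      simp only [hE, map_sub, Derivation.coeffwise_X, Derivation.coeffwise_C, pderiv_X,
        Polynomial.derivative_X, Polynomial.derivative_C]
      rw [Finset.sum_eq_single k (fun i _ hi => by simp [hi.symm]) (by simp)]
      simp
      ring
  rw [hE] at h
  simpa [rootProduct] using h

variable [Fintype σ] [DecidableEq σ] [CharZero K] {a : σ → ℕ}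
  {p : Polynomial (MvPolynomial σ K)}

theorem euler_eval_antiderivative (hp : Polynomial.derivative p = rootProduct a)
    (hp0 : p.coeff 0 = 0) (j : σ) :
    C ((∑ k, a k : ℕ) + 1 : K) * p.eval (X j) = ∑ k, X k * pderiv k (p.eval (X j)) := by
  have key : Polynomial.X * Polynomial.derivative p +
      ∑ k, Polynomial.C (X k) * (pderiv k).coeffwise p =
        Polynomial.C (C ((∑ k, a k : ℕ) + 1 : K)) * p := by
    apply Polynomial.eq_of_derivative_eq
    · have h := euler_rootProduct (K := K) a
      simp only [Polynomial.derivative_add, Polynomial.derivative_mul, Polynomial.derivative_X,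
        Polynomial.derivative_sum, Polynomial.derivative_C, Derivation.derivative_coeffwise, hp,
        one_mul, zero_mul, zero_add]
      rw [add_assoc, h]
      simp only [map_add, map_one, map_natCast]
      ring
    · simp [Polynomial.mul_coeff_zero, Derivation.coeff_coeffwise, hp0]
  have h := congrArg (Polynomial.eval (X j)) key
  simp only [Polynomial.eval_add, Polynomial.eval_mul, Polynomial.eval_X, Polynomial.eval_C,
    Polynomial.eval_finsetSum] at h
  simp only [Derivation.map_eval, mul_add, Finset.sum_add_distrib]
  rw [← h, add_comm]
  congr 1
  rw [Finset.sum_eq_single j (fun i _ hi => by simp [pderiv_X, hi.symm]) (by simp)]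
  simp

theorem pderiv_eval_antiderivative_add_single (hp : Polynomial.derivative p = rootProduct a)
    (hp0 : p.coeff 0 = 0) {q : Polynomial (MvPolynomial σ K)} {r : σ}
    (hq : Polynomial.derivative q = rootProduct (a + Pi.single r 1)) (hq0 : q.coeff 0 = 0)
    (i j : σ) :
    pderiv i (q.eval (X j)) = (X i - X r) * pderiv i (p.eval (X j)) -
      C (((a + (Pi.single r 1 : σ → ℕ)) i : ℕ) : K) * p.eval (X j) := by
  have hX : pderiv i (X r : MvPolynomial σ K) = ((Pi.single r 1 : σ → ℕ) i : ℕ) := by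
    rw [pderiv_X]
    by_cases h : i = r
    · subst h; simp
    · simp [h, Ne.symm h]
  have key : (pderiv i).coeffwise q = Polynomial.C (X i - X r) * (pderiv i).coeffwise p -
      Polynomial.C (C (((a + (Pi.single r 1 : σ → ℕ)) i : ℕ) : K)) * p := by
    apply Polynomial.eq_of_derivative_eq
    · have h := mul_coeffwise_pderiv_rootProduct (K := K) a i
      rw [Polynomial.derivative_sub, Polynomial.derivative_C_mul, Polynomial.derivative_C_mul]
      simp only [Derivation.derivative_coeffwise, hp, hq, rootProduct_add_single,
        Derivation.leibniz,
        smul_eq_mul, map_sub, Derivation.coeffwise_X, Derivation.coeffwise_C, hX, Pi.add_apply,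
        Nat.cast_add, map_add, map_natCast]
      linear_combination h
    · simp [Polynomial.mul_coeff_zero, Derivation.coeff_coeffwise, hp0, hq0]
  rw [Derivation.map_eval, Derivation.map_eval, key, hp, hq, rootProduct_add_single]
  simp only [Polynomial.eval_sub, Polynomial.eval_mul, Polynomial.eval_C, Polynomial.eval_X]
  by_cases h : i = j
  · subst h
    ring
  · rw [pderiv_X_of_ne (Ne.symm h)]
    ring

variable (p) in
/-- The matrix of the partial derivatives of the values of `p` at the variables. -/
noncomputable def criticalJacobian : Matrix σ σ (MvPolynomial σ K) :=
  Matrix.of fun i j => pderiv i (p.eval (X j))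

theorem det_criticalJacobian_add_single (hp : Polynomial.derivative p = rootProduct a)
    (hp0 : p.coeff 0 = 0) {q : Polynomial (MvPolynomial σ K)} {r : σ}
    (hq : Polynomial.derivative q = rootProduct (a + Pi.single r 1)) (hq0 : q.coeff 0 = 0) :
    C ((∑ i, a i : ℕ) + 1 : K) * (criticalJacobian q).det =
      -(C (a r + 1 : K) * X r) * (∏ i ∈ Finset.univ.erase r, (X i - X r)) *
        (criticalJacobian p).det := by
  have hc : ((∑ i, a i : ℕ) + 1 : K) ≠ 0 := Nat.cast_add_one_ne_zero _
  have hinv : C ((∑ i, a i : ℕ) + 1 : K) * C (((∑ i, a i : ℕ) + 1 : K)⁻¹) =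
      (1 : MvPolynomial σ K) := by rw [← C_mul, mul_inv_cancel₀ hc, C_1]
  let u : σ → K := fun i => ((a + (Pi.single r 1 : σ → ℕ)) i : ℕ)
  let v : σ → MvPolynomial σ K := fun k => C (((∑ i, a i : ℕ) + 1 : K)⁻¹) * X k
  have hur : u r = a r + 1 := by simp [u]
  have hmul : criticalJacobian q = (Matrix.diagonal (fun i => X i - X r) -
      Matrix.vecMulVec (fun i => algebraMap K (MvPolynomial σ K) (u i)) v) *
        criticalJacobian p := by
    ext1 i j
    have hG : p.eval (X j) = ∑ k, v k * pderiv k (p.eval (X j)) := by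
      simp only [v, mul_assoc, ← Finset.mul_sum]
      rw [← euler_eval_antiderivative hp hp0 j, ← mul_assoc, mul_comm (C _) (C _), hinv, one_mul]
    rw [Matrix.sub_mul, Matrix.sub_apply, Matrix.diagonal_mul, Matrix.mul_apply]
    simp only [criticalJacobian, Matrix.of_apply, Matrix.vecMulVec_apply, mul_assoc,
      ← Finset.mul_sum]
    rw [← hG]
    exact pderiv_eval_antiderivative_add_single hp hp0 hq hq0 i j
  rw [hmul, Matrix.det_mul, Matrix.det_diagonal_sub_vecMulVec _ v u r (sub_self _)
    (by rw [hur]; exact Nat.cast_add_one_ne_zero _), hur, algebraMap_eq]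
  simp only [v]
  linear_combination (-(C (a r + 1 : K) * X r) * (∏ i ∈ Finset.univ.erase r, (X i - X r)) *
        (criticalJacobian p).det) * hinv

theorem coeff_det_criticalJacobian (hp : Polynomial.derivative p = rootProduct a)
    (hp0 : p.coeff 0 = 0) :
    coeff (Finsupp.equivFunOnFinite.symm fun _ => ∑ i, a i) (criticalJacobian p).det =
      (-1 : K) ^ ∑ i, a i := by
  choose P hP hP0 using fun b : σ → ℕ =>
    Polynomial.exists_antiderivative (rootProduct b : Polynomial (MvPolynomial σ K))
  have hpP : p = P a := Polynomial.eq_of_derivative_eq (hp.trans (hP a).symm)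
    (hp0.trans (hP0 a).symm)
  rw [hpP]
  refine coeff_of_dyson_recurrence (fun b => (criticalJacobian (P b)).det) ?_ (fun b r =>
    det_criticalJacobian_add_single (hP b) (hP0 b) (hP _) (hP0 _)) _ a rfl
  have hX : P 0 = Polynomial.X := Polynomial.eq_of_derivative_eq
    (by rw [hP]; simp [rootProduct]) (by rw [hP0, Polynomial.coeff_X_zero])
  have hone : criticalJacobian (P 0) = 1 := by
    ext1 i j
    simp [criticalJacobian, hX, pderiv_X, Matrix.one_apply, Pi.single_apply, eq_comm]
  simp only [hone, Matrix.det_one]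

end MvPolynomial


/-- The coefficient of the monomial `∏_j z_j^n` in `det J_a` equals `(-1)^n`.  (This is
equivalent to Dyson's conjecture via the factorization of `det J_a`.) -/
theorem coeff_det_jacobian_eq_neg_one_pow
    (m n : ℕ) (a : Fin m → ℕ) (ha : ∀ i, 0 < a i) (hn : n = ∑ i, a i)
    (p : Polynomial (MvPolynomial (Fin m) ℂ))
    (hp : Polynomial.derivative p =
      ∏ i, (Polynomial.X - Polynomial.C (MvPolynomial.X i)) ^ a i)
    (hp0 : p.coeff 0 = 0)
    (J : Matrix (Fin m) (Fin m) (MvPolynomial (Fin m) ℂ))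
    (hJ : ∀ i j, J i j = MvPolynomial.pderiv i (Polynomial.eval (MvPolynomial.X j) p)) :
    MvPolynomial.coeff (Finsupp.equivFunOnFinite.symm fun _ => n) J.det = (-1 : ℂ) ^ n := by
  subst hn
  have hJ' : J = MvPolynomial.criticalJacobian p := Matrix.ext hJ
  rw [hJ']
  exact MvPolynomial.coeff_det_criticalJacobian hp hp0
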